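/- arXiv:2504.04951 — 6 statements merged into one kernel-verified Lean document; each statement's English description precedes it below -/
import Mathlib

section
/- For every biquadratic function v : ℝ² → ℝ and every point (x,y) ∈ [0,1]², the anisotropic remainder satisfies (Ê v)(x,y) = (1/4) · (∂⁴v/∂x²∂y²)(x,y) · x·y·(1−x)·(1−y). (Since v is biquadratic, ∂⁴v/∂x²∂y² = 4·a₂₂ is constant, so equivalently (Ê v)(x,y) = a₂₂·x·y·(1−x)·(1−y).) -/
open scoped BigOperators

/-- Bilinear corner interpolation on the unit square. -/
noncomputable def Rop (v : ℝ → ℝ → ℝ) (x y : ℝ) : ℝ :=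
  (1 - x) * (1 - y) * v 0 0 + x * (1 - y) * v 1 0 + (1 - x) * y * v 0 1 + x * y * v 1 1

/-- Linear interpolation in the second coordinate. -/
noncomputable def R1op (v : ℝ → ℝ → ℝ) (x y : ℝ) : ℝ :=
  (1 - y) * v x 0 + y * v x 1

/-- Linear interpolation in the first coordinate. -/
noncomputable def R2op (v : ℝ → ℝ → ℝ) (x y : ℝ) : ℝ :=
  (1 - x) * v 0 y + x * v 1 y

/-- The anisotropic remainder operator Ê v := v + R v − R₁ v − R₂ v. -/
noncomputable def Eop (v : ℝ → ℝ → ℝ) (x y : ℝ) : ℝ :=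
  v x y + Rop v x y - R1op v x y - R2op v x y

/-- The mixed fourth derivative ∂⁴v/∂x²∂y². -/
noncomputable def d22 (v : ℝ → ℝ → ℝ) (x y : ℝ) : ℝ :=
  iteratedDeriv 2 (fun s => iteratedDeriv 2 (fun t => v s t) y) x

/-- The second derivative of a quadratic polynomial. -/
theorem iteratedDeriv_two_quadratic (c b d : ℝ) (t : ℝ) :
    iteratedDeriv 2 (fun t : ℝ => c + b * t + d * t ^ 2) t = 2 * d := by
  have h1 : deriv (fun t : ℝ => c + b * t + d * t ^ 2) = fun t => b + 2 * d * t := by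
    funext s
    have h := (((hasDerivAt_id s).const_mul b).const_add c).add
      (((hasDerivAt_id s).pow 2).const_mul d)
    have h' : HasDerivAt (fun t : ℝ => c + b * t + d * t ^ 2) (b + 2 * d * s) s := by
      refine HasDerivAt.congr_deriv h ?_
      simp
      ring
    exact h'.deriv
  have h2 : HasDerivAt (fun t : ℝ => b + 2 * d * t) (2 * d) t := by
    simpa using ((hasDerivAt_id t).const_mul (2 * d)).const_add b
  rw [iteratedDeriv_succ, iteratedDeriv_one, h1]
  exact h2.deriv

theorem remainder_formula_on_unit_square (v : ℝ → ℝ → ℝ) (a : Fin 3 → Fin 3 → ℝ)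
    (hv : ∀ x y : ℝ, v x y = ∑ i : Fin 3, ∑ j : Fin 3, a i j * x ^ (i : ℕ) * y ^ (j : ℕ))
    (x y : ℝ) (hx : x ∈ Set.Icc (0:ℝ) 1) (hy : y ∈ Set.Icc (0:ℝ) 1) :
    Eop v x y = (1/4) * d22 v x y * (x * y * (1 - x) * (1 - y)) := by
  have hd : d22 v x y = 4 * a 2 2 := by
    have e1 : ∀ s : ℝ, iteratedDeriv 2 (fun t => v s t) y
        = 2 * a 0 2 + 2 * a 1 2 * s + 2 * a 2 2 * s ^ 2 := by
      intro s
      have : (fun t => v s t) = fun t : ℝ =>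
          (a 0 0 + a 1 0 * s + a 2 0 * s ^ 2) + (a 0 1 + a 1 1 * s + a 2 1 * s ^ 2) * t
            + (a 0 2 + a 1 2 * s + a 2 2 * s ^ 2) * t ^ 2 := by
        funext t
        rw [hv]
        simp [Fin.sum_univ_three]
        ring
      rw [this, iteratedDeriv_two_quadratic]
      ring
    unfold d22
    simp only [e1]
    rw [iteratedDeriv_two_quadratic]
    ring
  rw [hd]
  simp only [Eop, Rop, R1op, R2op, hv]
  simp [Fin.sum_univ_three]
  ring
end

section
/- For every biquadratic function v : ℝ² → ℝ and all (x,y) ∈ ℝ², the total interpolation error against the bilinear corner interpolant admits the anisotropic expansion v(x,y) − (R v)(x,y) = −(1/2)·(∂²v/∂x²)(x,y)·x(1−x) − (1/2)·(∂²v/∂y²)(x,y)·y(1−y) − (1/4)·(∂⁴v/∂x²∂y²)(x,y)·x(1−x)·y(1−y). -/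
open scoped BigOperators

/-- Second partial derivative in the first coordinate ∂²v/∂x². -/
noncomputable def dxx (v : ℝ → ℝ → ℝ) (x y : ℝ) : ℝ :=
  iteratedDeriv 2 (fun s => v s y) x

/-- Second partial derivative in the second coordinate ∂²v/∂y². -/
noncomputable def dyy (v : ℝ → ℝ → ℝ) (x y : ℝ) : ℝ :=
  iteratedDeriv 2 (fun t => v x t) y

/-- Second derivative of a quadratic polynomial. -/
theorem iteratedDeriv_two_quadratic_s3 (f : ℝ → ℝ) (c b d : ℝ)
    (hf : ∀ s, f s = c + b * s + d * s ^ 2) (x : ℝ) : iteratedDeriv 2 f x = 2 * d := by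
  have h1 : deriv f = fun s => b + 2 * d * s := by
    funext s
    rw [funext hf]
    have h := (((hasDerivAt_id s).const_mul b).const_add c).add
      (((hasDerivAt_id s).pow 2).const_mul d)
    have h' : HasDerivAt (fun s : ℝ => c + b * s + d * s ^ 2) (b + 2 * d * s) s := by
      refine h.congr_deriv ?_
      simp
      ring
    exact h'.deriv
  have h2 : HasDerivAt (fun s : ℝ => b + 2 * d * s) (2 * d) x := by
    have h := ((hasDerivAt_id x).const_mul (2 * d)).const_add b
    refine h.congr_deriv ?_
    simp
  rw [iteratedDeriv_succ, iteratedDeriv_one, h1]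
  exact h2.deriv

theorem bilinear_interpolation_error_expansion (v : ℝ → ℝ → ℝ) (a : Fin 3 → Fin 3 → ℝ)
    (hv : ∀ x y : ℝ, v x y = ∑ i : Fin 3, ∑ j : Fin 3, a i j * x ^ (i : ℕ) * y ^ (j : ℕ))
    (x y : ℝ) :
    v x y - Rop v x y =
      -(1/2) * dxx v x y * (x * (1 - x)) - (1/2) * dyy v x y * (y * (1 - y))
        - (1/4) * d22 v x y * (x * (1 - x) * (y * (1 - y))) := by
  have hxx : dxx v x y = 2 * (a 2 0 + a 2 1 * y + a 2 2 * y ^ 2) :=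
    iteratedDeriv_two_quadratic_s3 _ (a 0 0 + a 0 1 * y + a 0 2 * y ^ 2)
      (a 1 0 + a 1 1 * y + a 1 2 * y ^ 2) _
      (fun s => by simp [hv, Fin.sum_univ_three]; ring) x
  have hyy : ∀ x y, iteratedDeriv 2 (fun t => v x t) y
      = 2 * (a 0 2 + a 1 2 * x + a 2 2 * x ^ 2) := fun x y =>
    iteratedDeriv_two_quadratic_s3 _ (a 0 0 + a 1 0 * x + a 2 0 * x ^ 2)
      (a 0 1 + a 1 1 * x + a 2 1 * x ^ 2) _
      (fun s => by simp [hv, Fin.sum_univ_three]; ring) y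
  have h22 : d22 v x y = 2 * (2 * a 2 2) :=
    iteratedDeriv_two_quadratic_s3 _ (2 * a 0 2) (2 * a 1 2) _
      (fun s => by rw [hyy]; ring) x
  have hyy' : dyy v x y = 2 * (a 0 2 + a 1 2 * x + a 2 2 * x ^ 2) := hyy x y
  rw [hxx, hyy', h22]
  simp [Rop, hv, Fin.sum_univ_three]
  ring
end

section
/- For every biquadratic function v : ℝ² → ℝ and every (x,y) ∈ [0,1]², the anisotropic remainder satisfies the uniform bound |(Ê v)(x,y)| ≤ (1/16) · sup_{(s,t) ∈ [0,1]²} |(∂⁴v/∂x²∂y²)(s,t)|. -/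
open scoped BigOperators

theorem quad_iteratedDeriv (p q r z : ℝ) :
    iteratedDeriv 2 (fun t : ℝ => p + q * t + r * t ^ 2) z = 2 * r := by
  have h1 : deriv (fun t : ℝ => p + q * t + r * t ^ 2) = fun t => q + 2 * r * t := by
    funext t
    have h := (((hasDerivAt_id t).const_mul q).const_add p).add
      (((hasDerivAt_id t).pow 2).const_mul r)
    refine HasDerivAt.deriv (HasDerivAt.congr_deriv h ?_)
    simp
    ring
  have h2 : HasDerivAt (fun t : ℝ => q + 2 * r * t) (2 * r) z := by
    refine (((hasDerivAt_id z).const_mul (2 * r)).const_add q).congr_deriv ?_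
    simp
  rw [iteratedDeriv_succ, iteratedDeriv_one, h1]
  exact h2.deriv

theorem remainder_uniform_bound (v : ℝ → ℝ → ℝ) (a : Fin 3 → Fin 3 → ℝ)
    (hv : ∀ x y : ℝ, v x y = ∑ i : Fin 3, ∑ j : Fin 3, a i j * x ^ (i : ℕ) * y ^ (j : ℕ))
    (x y : ℝ) (hx : x ∈ Set.Icc (0:ℝ) 1) (hy : y ∈ Set.Icc (0:ℝ) 1) :
    |Eop v x y| ≤ (1/16) *
      ⨆ (s : Set.Icc (0:ℝ) 1) (t : Set.Icc (0:ℝ) 1), |d22 v (s : ℝ) (t : ℝ)| := by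
  have hd : ∀ s t : ℝ, d22 v s t = 4 * a 2 2 := by
    intro s t
    have hi : (fun s => iteratedDeriv 2 (fun t => v s t) t) =
        fun s => 2 * a 0 2 + 2 * a 1 2 * s + 2 * a 2 2 * s ^ 2 := by
      funext s
      have he : (fun t => v s t) = fun t => (a 0 0 + a 1 0 * s + a 2 0 * s ^ 2)
          + (a 0 1 + a 1 1 * s + a 2 1 * s ^ 2) * t
          + (a 0 2 + a 1 2 * s + a 2 2 * s ^ 2) * t ^ 2 := by
        funext t
        rw [hv]
        simp [Fin.sum_univ_three]
        ring
      rw [he, quad_iteratedDeriv]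
      ring
    unfold d22
    rw [hi, quad_iteratedDeriv]
    ring
  have hE : Eop v x y = a 2 2 * ((x * (1 - x)) * (y * (1 - y))) := by
    simp only [Eop, Rop, R1op, R2op, hv]
    simp [Fin.sum_univ_three]
    ring
  haveI : Nonempty (Set.Icc (0:ℝ) 1) := ⟨⟨x, hx⟩⟩
  simp only [hd, ciSup_const]
  obtain ⟨hx0, hx1⟩ := hx
  obtain ⟨hy0, hy1⟩ := hy
  have hX : 0 ≤ x * (1 - x) := mul_nonneg hx0 (by linarith)
  have hY : 0 ≤ y * (1 - y) := mul_nonneg hy0 (by linarith)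
  have hX4 : x * (1 - x) ≤ 1 / 4 := by nlinarith [sq_nonneg (x - 1 / 2)]
  have hY4 : y * (1 - y) ≤ 1 / 4 := by nlinarith [sq_nonneg (y - 1 / 2)]
  have hXY : (x * (1 - x)) * (y * (1 - y)) ≤ 1 / 4 := by nlinarith
  rw [hE, abs_mul, abs_of_nonneg (mul_nonneg hX hY), abs_mul, abs_of_pos (by norm_num : (0:ℝ) < 4)]
  nlinarith [mul_le_mul_of_nonneg_left hXY (abs_nonneg (a 2 2))]
end

section
/- Let h₁, h₂ > 0, (x̃₁, x̃₂) ∈ ℝ², K := [x̃₁, x̃₁+h₁] × [x̃₂, x̃₂+h₂], and let T : ℝ² → ℝ² be the affine map T(x̂₁, x̂₂) := (x̃₁ + h₁ x̂₁, x̃₂ + h₂ x̂₂), which maps [0,1]² bijectively onto K. Let v : ℝ² → ℝ be a function such that v ∘ T is biquadratic, and define the mapped anisotropic remainder (𝔼 v)(x) := (Ê (v ∘ T))(T⁻¹(x)) for x ∈ K. Then for every x ∈ K, |(𝔼 v)(x)| ≤ (1/16) · sup_{y ∈ K} |(∂⁴v/∂x₁²∂x₂²)(y)| · h₁² · h₂².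 -/
open scoped BigOperators

theorem aux_deriv2 (A B C c h : ℝ) (x : ℝ) :
    iteratedDeriv 2 (fun s : ℝ => A + B * ((s - c) / h) + C * ((s - c) / h) ^ 2) x
      = 2 * C / h ^ 2 := by
  have h1 : deriv (fun s : ℝ => A + B * ((s - c) / h) + C * ((s - c) / h) ^ 2)
      = fun s => B / h + C * (2 * ((s - c) / h) * (1 / h)) := by
    funext s
    have hd : HasDerivAt (fun s : ℝ => (s - c) / h) (1 / h) s :=
      ((hasDerivAt_id s).sub_const c).div_const h
    have := (((hd.const_mul B).const_add A).add ((hd.pow 2).const_mul C)).deriv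
    refine Eq.trans ?_ (this.trans ?_)
    · rfl
    · simp; ring
  rw [iteratedDeriv_succ, iteratedDeriv_one, h1]
  have hd : HasDerivAt (fun s : ℝ => (s - c) / h) (1 / h) x :=
    ((hasDerivAt_id x).sub_const c).div_const h
  have := ((((hd.const_mul 2).mul_const (1 / h)).const_mul C).const_add (B / h)).deriv
  refine Eq.trans ?_ (this.trans ?_)
  · rfl
  · ring

theorem mapped_remainder_bound (h₁ h₂ : ℝ) (hh₁ : 0 < h₁) (hh₂ : 0 < h₂)
    (xt₁ xt₂ : ℝ) (v : ℝ → ℝ → ℝ) (a : Fin 3 → Fin 3 → ℝ)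
    (hv : ∀ xh₁ xh₂ : ℝ, v (xt₁ + h₁ * xh₁) (xt₂ + h₂ * xh₂) =
      ∑ i : Fin 3, ∑ j : Fin 3, a i j * xh₁ ^ (i : ℕ) * xh₂ ^ (j : ℕ))
    (x₁ x₂ : ℝ) (hx₁ : x₁ ∈ Set.Icc xt₁ (xt₁ + h₁)) (hx₂ : x₂ ∈ Set.Icc xt₂ (xt₂ + h₂)) :
    |Eop (fun xh₁ xh₂ => v (xt₁ + h₁ * xh₁) (xt₂ + h₂ * xh₂))
        ((x₁ - xt₁) / h₁) ((x₂ - xt₂) / h₂)| ≤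
      (1/16) *
        (⨆ (y₁ : Set.Icc xt₁ (xt₁ + h₁)) (y₂ : Set.Icc xt₂ (xt₂ + h₂)),
          |d22 v (y₁ : ℝ) (y₂ : ℝ)|) * h₁ ^ 2 * h₂ ^ 2 := by
  have hv' : ∀ s t : ℝ, v s t = ∑ i : Fin 3, ∑ j : Fin 3,
      a i j * ((s - xt₁) / h₁) ^ (i : ℕ) * ((t - xt₂) / h₂) ^ (j : ℕ) := by
    intro s t
    rw [← hv]
    congr 1 <;> field_simp <;> ring
  have hd : ∀ x y : ℝ, d22 v x y = 4 * a 2 2 / (h₁ ^ 2 * h₂ ^ 2) := by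
    intro x y
    unfold d22
    have e1 : ∀ s : ℝ, iteratedDeriv 2 (fun t => v s t) y
        = (2 * a 0 2 / h₂ ^ 2) + (2 * a 1 2 / h₂ ^ 2) * ((s - xt₁) / h₁)
          + (2 * a 2 2 / h₂ ^ 2) * ((s - xt₁) / h₁) ^ 2 := by
      intro s
      set p := (s - xt₁) / h₁ with hp
      have e2 : (fun t => v s t) = fun t =>
          (a 0 0 + a 1 0 * p + a 2 0 * p ^ 2)
          + (a 0 1 + a 1 1 * p + a 2 1 * p ^ 2) * ((t - xt₂) / h₂)
          + (a 0 2 + a 1 2 * p + a 2 2 * p ^ 2) * ((t - xt₂) / h₂) ^ 2 := by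
        funext t
        rw [hv' s t, ← hp]
        simp [Fin.sum_univ_three]
        ring
      rw [e2, aux_deriv2]
      ring
    simp_rw [e1]
    rw [aux_deriv2]
    field_simp
    ring
  have hE : Eop (fun xh₁ xh₂ => v (xt₁ + h₁ * xh₁) (xt₂ + h₂ * xh₂))
      ((x₁ - xt₁) / h₁) ((x₂ - xt₂) / h₂)
      = a 2 2 * (((x₁ - xt₁) / h₁) * (1 - (x₁ - xt₁) / h₁)
        * (((x₂ - xt₂) / h₂) * (1 - (x₂ - xt₂) / h₂))) := by
    generalize (x₁ - xt₁) / h₁ = p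
    generalize (x₂ - xt₂) / h₂ = q
    simp only [Eop, Rop, R1op, R2op, hv]
    simp [Fin.sum_univ_three]
    ring
  have : Nonempty (Set.Icc xt₁ (xt₁ + h₁)) := ⟨⟨x₁, hx₁⟩⟩
  have : Nonempty (Set.Icc xt₂ (xt₂ + h₂)) := ⟨⟨x₂, hx₂⟩⟩
  simp only [hd, ciSup_const]
  rw [hE, abs_mul, abs_div, abs_mul 4, abs_of_pos (show (0 : ℝ) < h₁ ^ 2 * h₂ ^ 2 by positivity)]
  have key : ∀ x c h : ℝ, 0 < h → x ∈ Set.Icc c (c + h) →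
      0 ≤ (x - c) / h * (1 - (x - c) / h) ∧ (x - c) / h * (1 - (x - c) / h) ≤ 1 / 4 := by
    intro x c h hh hx
    have h0 : 0 ≤ (x - c) / h := div_nonneg (by linarith [hx.1]) hh.le
    have h1 : (x - c) / h ≤ 1 := by rw [div_le_one hh]; linarith [hx.2]
    exact ⟨mul_nonneg h0 (by linarith), by nlinarith [sq_nonneg ((x - c) / h - 1 / 2)]⟩
  obtain ⟨p0, p1⟩ := key x₁ xt₁ h₁ hh₁ hx₁
  obtain ⟨q0, q1⟩ := key x₂ xt₂ h₂ hh₂ hx₂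
  have hpq := mul_le_mul p1 q1 q0 (by norm_num)
  rw [abs_of_nonneg (mul_nonneg p0 q0)]
  have hr : 1 / 16 * (|(4 : ℝ)| * |a 2 2| / (h₁ ^ 2 * h₂ ^ 2)) * h₁ ^ 2 * h₂ ^ 2
      = |a 2 2| * (1 / 4) := by
    rw [abs_of_pos (by norm_num : (0 : ℝ) < 4)]
    field_simp
    norm_num
  rw [hr]
  exact mul_le_mul_of_nonneg_left (by linarith) (abs_nonneg _)
end

section
/- For all x, x̃ ∈ X, setting e := x − x̃, one has L(x) − L(x̃) = (1/2)·(L′(x)(e) + L′(x̃)(e)) + (1/2)·∫₀¹ L′′′(x̃ + s·e)(e,e,e)·s·(s−1) ds. -/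
theorem dwr_hasDerivAt_aux {X : Type*} [NormedAddCommGroup X] [NormedSpace ℝ X]
    (L : X → ℝ) (hL : ContDiff ℝ 3 L) (a e : X) (k : ℕ) (hk : k < 3) (s : ℝ) :
    HasDerivAt (fun s : ℝ => iteratedFDeriv ℝ k L (a + s • e) fun _ => e)
      (iteratedFDeriv ℝ (k + 1) L (a + s • e) fun _ => e) s := by
  have hd : Differentiable ℝ (fun x => iteratedFDeriv ℝ k L x) :=
    hL.differentiable_iteratedFDeriv (by exact_mod_cast hk)
  have h1 : HasDerivAt (fun s : ℝ => a + s • e) e s := by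
    simpa using ((hasDerivAt_id s).smul_const e).const_add a
  have h2 := (hd (a + s • e)).hasFDerivAt.comp_hasDerivAt s h1
  exact ((ContinuousMultilinearMap.apply ℝ (fun _ : Fin k => X) ℝ
    (fun _ => e)).hasFDerivAt.comp_hasDerivAt s h2)

theorem dwr_trapezoidal_identity {X : Type*} [NormedAddCommGroup X] [NormedSpace ℝ X]
    [CompleteSpace X] (L : X → ℝ) (hL : ContDiff ℝ 3 L) (x xt : X) :
    L x - L xt = (1/2) * (fderiv ℝ L x (x - xt) + fderiv ℝ L xt (x - xt))
      + (1/2) * ∫ s in (0:ℝ)..1,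
          (iteratedFDeriv ℝ 3 L (xt + s • (x - xt)) fun _ => x - xt) * (s * (s - 1)) := by
  have h := dwr_hasDerivAt_aux L hL xt (x - xt)
  have hc : Continuous fun s : ℝ =>
      (iteratedFDeriv ℝ 3 L (xt + s • (x - xt)) fun _ => x - xt) * (s * (s - 1)) := by
    have h3 : Continuous (iteratedFDeriv ℝ 3 L) := hL.continuous_iteratedFDeriv (by norm_num)
    have h4 : Continuous fun s : ℝ => iteratedFDeriv ℝ 3 L (xt + s • (x - xt)) :=
      h3.comp (by fun_prop)
    have h5 := (ContinuousMultilinearMap.apply ℝ (fun _ : Fin 3 => X) ℝ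
      (fun _ => x - xt)).continuous.comp h4
    exact h5.mul (by fun_prop)
  let g1 : ℝ → ℝ := fun s => iteratedFDeriv ℝ 1 L (xt + s • (x - xt)) fun _ => x - xt
  let g2 : ℝ → ℝ := fun s => iteratedFDeriv ℝ 2 L (xt + s • (x - xt)) fun _ => x - xt
  let g3 : ℝ → ℝ := fun s => iteratedFDeriv ℝ 3 L (xt + s • (x - xt)) fun _ => x - xt
  have key := intervalIntegral.integral_eq_sub_of_hasDerivAt (a := 0) (b := 1)
    (f := fun s : ℝ =>
      (iteratedFDeriv ℝ 2 L (xt + s • (x - xt)) fun _ => x - xt) * (s * (s - 1))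
      - (iteratedFDeriv ℝ 1 L (xt + s • (x - xt)) fun _ => x - xt) * (2 * s - 1)
      + 2 * (iteratedFDeriv ℝ 0 L (xt + s • (x - xt)) fun _ => x - xt))
    (fun s _ => by
      have p : HasDerivAt (fun s : ℝ => s * (s - 1)) (2 * s - 1) s := by
        refine ((hasDerivAt_id s).mul ((hasDerivAt_id s).sub_const 1)).congr_deriv ?_
        simp only [id]
        ring
      have q : HasDerivAt (fun s : ℝ => 2 * s - 1) 2 s := by
        simpa using ((hasDerivAt_id s).const_mul 2).sub_const 1
      have := (((h 2 (by norm_num) s).mul p).sub ((h 1 (by norm_num) s).mul q)).add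
        ((h 0 (by norm_num) s).const_mul 2)
      refine this.congr_deriv ?_
      change g3 s * (s * (s - 1)) + g2 s * (2 * s - 1) - (g2 s * (2 * s - 1) + g1 s * 2)
        + 2 * g1 s = g3 s * (s * (s - 1))
      ring) (hc.intervalIntegrable 0 1)
  rw [key]
  simp [iteratedFDeriv_one_apply]
  ring
end

section
/- Suppose u, z ∈ V satisfy the primal and adjoint equations on V, i.e. B(u, φ) = F(φ) for all φ ∈ V and B′_u(u)(φ, z) = J′(u)(φ) for all φ ∈ V, and suppose u_h, z_h ∈ V_h satisfy the corresponding discrete equations, i.e. B(u_h, φ) = F(φ) for all φ ∈ V_h and B′_u(u_h)(φ, z_h) = J′(u_h)(φ) for all φ ∈ V_h. Then for all ũ, z̃ ∈ V_h: J(u) − J(u_h) = (1/2)·ρ(u_h)(z − z̃) + (1/2)·ρ*(u_h, z_h)(u − ũ) + R, where R := (1/2)·∫₀¹ L′′′((u_h, z_h) + s·e)(e,e,e)·s·(s−1) ds is the higher-order remainder, with e := (u − u_h, z − z_h) ∈ V × V. -/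
theorem dwr_aux_deriv {E : Type*} [NormedAddCommGroup E] [NormedSpace ℝ E]
    (L : E → ℝ) (hL : ContDiff ℝ 3 L) (x e : E) (k : ℕ) (hk : k < 3) (s : ℝ) :
    HasDerivAt (fun s : ℝ => iteratedFDeriv ℝ k L (x + s • e) fun _ => e)
      (iteratedFDeriv ℝ (k+1) L (x + s • e) fun _ => e) s := by
  have h1 : HasDerivAt (fun s : ℝ => x + s • e) e s := by
    simpa using ((hasDerivAt_id s).smul_const e).const_add x
  have h2 : HasFDerivAt (iteratedFDeriv ℝ k L)
      (fderiv ℝ (iteratedFDeriv ℝ k L) (x + s • e)) (x + s • e) :=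
    ((hL.differentiable_iteratedFDeriv (by exact_mod_cast hk)) _).hasFDerivAt
  have h3 := h2.comp_hasDerivAt s h1
  have h4 := (ContinuousMultilinearMap.apply ℝ (fun _ : Fin k => E) ℝ
    (fun _ => e)).hasFDerivAt.comp_hasDerivAt s h3
  rw [iteratedFDeriv_succ_apply_left]
  exact h4

theorem dwr_aux_taylor {E : Type*} [NormedAddCommGroup E] [NormedSpace ℝ E]
    (L : E → ℝ) (hL : ContDiff ℝ 3 L) (x e : E) :
    ∫ s in (0:ℝ)..1, (iteratedFDeriv ℝ 3 L (x + s • e) fun _ => e) * (s * (s - 1)) =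
      2 * (L (x + e) - L x) - fderiv ℝ L x e - fderiv ℝ L (x + e) e := by
  have d0 := dwr_aux_deriv L hL x e 0 (by norm_num)
  have d1 := dwr_aux_deriv L hL x e 1 (by norm_num)
  have d2 := dwr_aux_deriv L hL x e 2 (by norm_num)
  have hc : Continuous fun s : ℝ => iteratedFDeriv ℝ 3 L (x + s • e) fun _ => e := by
    have := hL.continuous_iteratedFDeriv (m := 3) (by norm_num)
    exact (ContinuousMultilinearMap.apply ℝ (fun _ : Fin 3 => E) ℝ
      (fun _ => e)).continuous.comp (this.comp (by fun_prop))
  rw [intervalIntegral.integral_eq_sub_of_hasDerivAt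
    (f := fun s => (iteratedFDeriv ℝ 2 L (x + s • e) fun _ => e) * (s * (s - 1))
      - (iteratedFDeriv ℝ 1 L (x + s • e) fun _ => e) * (2 * s - 1)
      + 2 * (iteratedFDeriv ℝ 0 L (x + s • e) fun _ => e))]
  · simp
    ring
  · intro s _
    have p1 : HasDerivAt (fun s : ℝ => s * (s - 1)) (2 * s - 1) s := by
      have := (hasDerivAt_id s).mul ((hasDerivAt_id s).sub_const 1)
      refine this.congr_deriv ?_
      simp; ring
    have p2 : HasDerivAt (fun s : ℝ => 2 * s - 1) 2 s := by
      simpa using ((hasDerivAt_id s).const_mul 2).sub_const 1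
    refine ((((d2 s).mul p1).sub ((d1 s).mul p2)).add ((d0 s).const_mul 2)).congr_deriv ?_
    simp only [Nat.reduceAdd, zero_add]
    ring
  · exact (hc.mul (by fun_prop)).intervalIntegrable _ _

theorem dwr_aux_fderiv {V : Type*} [NormedAddCommGroup V] [NormedSpace ℝ V]
    (J : V → ℝ) (hJ : ContDiff ℝ 3 J) (F : V →L[ℝ] ℝ)
    (B : V → V → ℝ) (hB : ContDiff ℝ 3 (fun p : V × V => B p.1 p.2))
    (hBlin : ∀ v : V, IsLinearMap ℝ (fun w => B v w)) (v w a b : V) :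
    fderiv ℝ (fun p : V × V => J p.1 + F p.2 - B p.1 p.2) (v, w) (a, b) =
      fderiv ℝ J v a - fderiv ℝ (fun v => B v w) v a + (F b - B v b) := by
  have hBd := (hB.differentiable (by norm_num) (v, w)).hasFDerivAt
  have hJd := (hJ.differentiable (by norm_num) v).hasFDerivAt
  have hL := ((hJd.comp (v, w) (hasFDerivAt_fst (𝕜 := ℝ) (E := V) (F := V))).add
    (F.hasFDerivAt.comp (v, w) (hasFDerivAt_snd (𝕜 := ℝ) (E := V) (F := V)))).sub hBd
  have e1 : fderiv ℝ (fun p : V × V => J p.1 + F p.2 - B p.1 p.2) (v, w) = _ := hL.fderiv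
  have e2 := (hBd.comp v (hasFDerivAt_prodMk_left (𝕜 := ℝ) v w)).fderiv
  have e2' : fderiv ℝ (fun v => B v w) v = _ := e2
  have l1 : HasDerivAt (fun s : ℝ => (v, w + s • b)) ((0 : V), b) 0 := by
    refine (hasDerivAt_const _ _).prodMk ?_
    simpa using ((hasDerivAt_id (0:ℝ)).smul_const b).const_add w
  have hBd' : HasFDerivAt (fun p : V × V => B p.1 p.2)
      (fderiv ℝ (fun p : V × V => B p.1 p.2) (v, w)) (v, w + (0:ℝ) • b) := by simpa using hBd
  have l2 := hBd'.comp_hasDerivAt (0:ℝ) l1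
  have l3 : HasDerivAt (fun s : ℝ => B v w + s * B v b) (B v b) 0 := by
    simpa using ((hasDerivAt_id (0:ℝ)).mul_const (B v b)).const_add (B v w)
  have l4 : ((fun p : V × V => B p.1 p.2) ∘ fun s : ℝ => (v, w + s • b)) =
      fun s : ℝ => B v w + s * B v b := by
    funext s
    have h1 := (hBlin v).map_add w (s • b)
    have h2 := (hBlin v).map_smul s b
    simp only [smul_eq_mul] at h1 h2
    simp [h1, h2]
  rw [l4] at l2
  have e3 := l2.unique l3
  have e4 : ((a, b) : V × V) = (a, 0) + (0, b) := by simp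
  have e5 : fderiv ℝ (fun p : V × V => B p.1 p.2) (v, w) (a, b) =
      fderiv ℝ (fun p : V × V => B p.1 p.2) (v, w) (a, 0) + B v b := by
    rw [e4, map_add, e3]
  rw [e1, e2']
  simp [e5]
  ring


theorem dwr_error_representation {V : Type*} [NormedAddCommGroup V] [NormedSpace ℝ V]
    [CompleteSpace V] (Vh : Submodule ℝ V)
    (J : V → ℝ) (hJ : ContDiff ℝ 3 J)
    (F : V →L[ℝ] ℝ)
    (B : V → V → ℝ) (hB : ContDiff ℝ 3 (fun p : V × V => B p.1 p.2))
    (hBlin : ∀ v : V, IsLinearMap ℝ (fun w => B v w))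
    (u z : V)
    (hu : ∀ φ : V, B u φ = F φ)
    (hz : ∀ φ : V, fderiv ℝ (fun v => B v z) u φ = fderiv ℝ J u φ)
    (uh zh : V) (huh : uh ∈ Vh) (hzh : zh ∈ Vh)
    (huh' : ∀ φ ∈ Vh, B uh φ = F φ)
    (hzh' : ∀ φ ∈ Vh, fderiv ℝ (fun v => B v zh) uh φ = fderiv ℝ J uh φ)
    (ut zt : V) (hut : ut ∈ Vh) (hzt : zt ∈ Vh) :
    J u - J uh =
      (1/2) * (F (z - zt) - B uh (z - zt))
      + (1/2) * (fderiv ℝ J uh (u - ut) - fderiv ℝ (fun v => B v zh) uh (u - ut))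
      + (1/2) * ∫ s in (0:ℝ)..1,
          (iteratedFDeriv ℝ 3 (fun p : V × V => J p.1 + F p.2 - B p.1 p.2)
              ((uh, zh) + s • ((u - uh, z - zh) : V × V))
              fun _ => ((u - uh, z - zh) : V × V)) * (s * (s - 1)) := by

  have hL : ContDiff ℝ 3 (fun p : V × V => J p.1 + F p.2 - B p.1 p.2) :=
    ((hJ.comp contDiff_fst).add (F.contDiff.comp contDiff_snd)).sub hB
  rw [dwr_aux_taylor _ hL]
  have hx : ((uh, zh) + (u - uh, z - zh) : V × V) = (u, z) := by simp
  rw [hx, dwr_aux_fderiv J hJ F B hB hBlin, dwr_aux_fderiv J hJ F B hB hBlin, hz, hu]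
  have a1 := huh' zh hzh
  have a2 := huh' zt hzt
  have a3 := hzh' uh huh
  have a4 := hzh' ut hut
  have b1 : B uh (z - zt) = B uh z - B uh zt := (hBlin uh).map_sub z zt
  have b2 : B uh (z - zh) = B uh z - B uh zh := (hBlin uh).map_sub z zh
  simp only [b1, b2, map_sub, hu, a1, a2, a3, a4]
  ring
end
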